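/- Suppose there are at least three agents (I ≥ 3), the map θ ↦ (θ_i)_{i∈𝓘} is a bijection from Θ onto ×_{i∈𝓘} Θ_i, and the SCF f satisfies Maskin monotonicity. Then f is implementable in mixed-strategy Nash equilibria by a direct mechanism: there exists a direct mechanism 𝓜 such that for every state θ, (i) Γ(𝓜,θ) has a pure-strategy Nash equilibrium, and (ii) every m ∈ supp(NE(Γ(𝓜,θ))) satisfies g(m) = f(θ) and τ_i(m) = 0 for every agent i. -/

import Mathlib

/-!
STATEMENT 5 (Proposition 2): Suppose there are at least three agents (I ≥ 3), the map
θ ↦ (θ_i)_{i∈𝓘} is a bijection from Θ onto ×_{i∈𝓘} Θ_i, and the SCF f satisfies Maskin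
monotonicity. Then f is implementable in mixed-strategy Nash equilibria by a direct
mechanism.
-/

open scoped BigOperators Classical

noncomputable section

/-- The outcome space `X = Δ(A) × ℝ^I`. -/
abbrev Outc (A : Type) (I : ℕ) : Type := PMF A × (Fin I → ℝ)

/-- Expected utility of a countably supported lottery under Bernoulli utility `w`. -/
def eu {A : Type} (w : A → ℝ) (ℓ : PMF A) : ℝ := ∑' a, (ℓ a).toReal * w a

/-- Agent `i`'s quasilinear utility `ũ_i(x,θ) = v_i(ℓ,θ) + t_i`. -/
def uT {A Θ : Type} {I : ℕ} (w : Fin I → A → Θ → ℝ) (i : Fin I) (x : Outc A I) (θ : Θ) : ℝ :=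
  eu (fun a => w i a θ) x.1 + x.2 i

/-- The type of agent `i` at state `θ`: the expected-utility function `v_i(·,θ)`. -/
def typeOf {A Θ : Type} {I : ℕ} (w : Fin I → A → Θ → ℝ) (i : Fin I) (θ : Θ) : A → ℝ :=
  fun a => w i a θ

/-- Maskin monotonicity of an SCF `f : Θ → X`. -/
def MaskinMonotone {A Θ : Type} {I : ℕ} (w : Fin I → A → Θ → ℝ) (f : Θ → Outc A I) : Prop :=
  ∀ θ' θ : Θ, f θ' ≠ f θ →
    ∃ (i : Fin I) (x : Outc A I),
      uT w i x θ' ≤ uT w i (f θ') θ' ∧ uT w i (f θ') θ < uT w i x θ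

variable {A Θ : Type} {I : ℕ}

/-- Payoff in the game induced at state `θ` by a direct mechanism `(g,τ)`. -/
def payoffD (w : Fin I → A → Θ → ℝ) (g : (Fin I → Θ) → Outc A I)
    (τ : Fin I → (Fin I → Θ) → ℝ) (θ : Θ) (i : Fin I) (m : Fin I → Θ) : ℝ :=
  uT w i (g m) θ + τ i m

/-- A mixed-strategy profile in a direct mechanism. -/
def IsMixedProfileD [Fintype Θ] (σ : Fin I → Θ → ℝ) : Prop :=
  ∀ i, (∀ mi, 0 ≤ σ i mi) ∧ (∑ mi, σ i mi) = 1

/-- Expected payoff to agent `i` from the pure report `mi` against `σ_{-i}`. -/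
def expPayD [Fintype Θ] (w : Fin I → A → Θ → ℝ) (g : (Fin I → Θ) → Outc A I)
    (τ : Fin I → (Fin I → Θ) → ℝ) (θ : Θ) (σ : Fin I → Θ → ℝ) (i : Fin I) (mi : Θ) : ℝ :=
  ∑ m : Fin I → Θ,
    (∏ j ∈ Finset.univ.erase i, σ j (m j)) * (if m i = mi then payoffD w g τ θ i m else 0)

/-- Mixed-strategy Nash equilibrium of the game induced by a direct mechanism. -/
def IsNED [Fintype Θ] (w : Fin I → A → Θ → ℝ) (g : (Fin I → Θ) → Outc A I)
    (τ : Fin I → (Fin I → Θ) → ℝ) (θ : Θ) (σ : Fin I → Θ → ℝ) : Prop :=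
  IsMixedProfileD σ ∧
    ∀ (i : Fin I) (mi : Θ), 0 < σ i mi → ∀ mi' : Θ,
      expPayD w g τ θ σ i mi' ≤ expPayD w g τ θ σ i mi

/-- Pure-strategy Nash equilibrium of the game induced by a direct mechanism. -/
def IsPureNED (w : Fin I → A → Θ → ℝ) (g : (Fin I → Θ) → Outc A I)
    (τ : Fin I → (Fin I → Θ) → ℝ) (θ : Θ) (m : Fin I → Θ) : Prop :=
  ∀ (i : Fin I) (mi' : Θ),
    payoffD w g τ θ i (Function.update m i mi') ≤ payoffD w g τ θ i m

/-- `m` is played with positive probability under some mixed-strategy Nash equilibrium. -/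
def InSuppNED [Fintype Θ] (w : Fin I → A → Θ → ℝ) (g : (Fin I → Θ) → Outc A I)
    (τ : Fin I → (Fin I → Θ) → ℝ) (θ : Θ) (m : Fin I → Θ) : Prop :=
  ∃ σ, IsNED w g τ θ σ ∧ 0 < ∏ i, σ i (m i)

section Lotteries

theorem PMF.summable_toReal_mul (p : PMF A) {v : A → ℝ} {B : ℝ} (hv : ∀ a, |v a| ≤ B) :
    Summable fun a => (p a).toReal * v a := by
  have hs : Summable fun a => (p a).toReal := ENNReal.summable_toReal p.tsum_coe_ne_top
  refine Summable.of_norm_bounded (hs.mul_right B) fun a => ?_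
  rw [Real.norm_eq_abs, abs_mul, abs_of_nonneg ENNReal.toReal_nonneg]
  exact mul_le_mul_of_nonneg_left (hv a) ENNReal.toReal_nonneg

theorem PMF.tsum_toReal (p : PMF A) : ∑' a, (p a).toReal = 1 := by
  rw [← ENNReal.tsum_toReal_eq p.apply_ne_top, p.tsum_coe, ENNReal.toReal_one]

theorem eu_add_const (p : PMF A) {v : A → ℝ} {B : ℝ} (hv : ∀ a, |v a| ≤ B) (r : ℝ) :
    eu (fun a => v a + r) p = eu v p + r := by
  have hs : Summable fun a => (p a).toReal := ENNReal.summable_toReal p.tsum_coe_ne_top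
  simp only [eu, mul_add]
  rw [(p.summable_toReal_mul hv).tsum_add (hs.mul_right r), tsum_mul_right, p.tsum_toReal, one_mul]

theorem eu_pure (v : A → ℝ) (a : A) : eu v (PMF.pure a) = v a := by
  rw [eu, tsum_eq_single a]
  · simp
  · intro b hb
    simp [PMF.pure_apply, hb]

theorem eu_bind {ι : Type} [Fintype ι] (q : PMF ι) (p : ι → PMF A) {v : A → ℝ} {B : ℝ}
    (hv : ∀ a, |v a| ≤ B) : eu v (q.bind p) = ∑ k, (q k).toReal * eu v (p k) := by
  have h : ∀ a, ((q.bind p) a).toReal * v a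
      = ∑ k, (q k).toReal * ((p k a).toReal * v a) := by
    intro a
    rw [PMF.bind_apply, tsum_fintype,
      ENNReal.toReal_sum fun k _ => ENNReal.mul_ne_top (q.apply_ne_top k) ((p k).apply_ne_top a),
      Finset.sum_mul]
    simp only [ENNReal.toReal_mul, mul_assoc]
  simp only [eu, h]
  rw [Summable.tsum_finsetSum fun k _ => ((p k).summable_toReal_mul hv).mul_left _]
  simp only [tsum_mul_left]

/-- Finite randomizations over outcomes are outcomes, and utilities are affine in them. -/
theorem exists_mixture {ι : Type} [Fintype ι] (w : Fin I → A → Θ → ℝ) {B : ℝ}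
    (hB : ∀ i a θ, |w i a θ| ≤ B) (q : ι → ℝ) (hq : ∀ k, 0 ≤ q k) (hq1 : ∑ k, q k = 1)
    (x : ι → Outc A I) :
    ∃ z : Outc A I, ∀ i θ, uT w i z θ = ∑ k, q k * uT w i (x k) θ := by
  have hsum : ∑ k, ENNReal.ofReal (q k) = 1 := by
    rw [← ENNReal.ofReal_sum_of_nonneg fun k _ => hq k, hq1, ENNReal.ofReal_one]
  refine ⟨((PMF.ofFintype _ hsum).bind fun k => (x k).1, fun i => ∑ k, q k * (x k).2 i), ?_⟩
  intro i θ
  simp only [uT, mul_add, Finset.sum_add_distrib]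
  rw [eu_bind _ _ fun a => hB i a θ]
  simp only [PMF.ofFintype_apply, ENNReal.toReal_ofReal (hq _)]

theorem exists_average {ι : Type} [Fintype ι] [Nonempty ι] (w : Fin I → A → Θ → ℝ) {B : ℝ}
    (hB : ∀ i a θ, |w i a θ| ≤ B) (x : ι → Outc A I) :
    ∃ z : Outc A I, ∀ i θ, uT w i z θ = (Fintype.card ι : ℝ)⁻¹ * ∑ k, uT w i (x k) θ := by
  obtain ⟨z, hz⟩ := exists_mixture w hB (fun _ : ι => (Fintype.card ι : ℝ)⁻¹)
    (fun _ => by positivity) (by simp) x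
  exact ⟨z, fun i θ => by rw [hz, Finset.mul_sum]⟩

theorem exists_binary_mixture (w : Fin I → A → Θ → ℝ) {B : ℝ}
    (hB : ∀ i a θ, |w i a θ| ≤ B) {ε : ℝ} (h0 : 0 ≤ ε) (h1 : ε ≤ 1) (x y : Outc A I) :
    ∃ z : Outc A I, ∀ i θ, uT w i z θ = (1 - ε) * uT w i x θ + ε * uT w i y θ := by
  obtain ⟨z, hz⟩ := exists_mixture w hB (fun b : Bool => if b then ε else 1 - ε)
    (fun b => by cases b <;> simp [h0, h1]) (by simp) (fun b : Bool => if b then y else x)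
  exact ⟨z, fun i θ => by rw [hz, Fintype.sum_bool]; simp [add_comm]⟩

end Lotteries

section Types

/-- The type of agent `i` normalized to vanish at `a₀`: two states give agent `i` the same
preferences over outcomes as soon as the normalized types coincide. -/
def normType (w : Fin I → A → Θ → ℝ) (a₀ : A) (i : Fin I) (θ : Θ) : A → ℝ :=
  fun a => w i a θ - w i a₀ θ

theorem uT_eq_add_of_normType_eq {w : Fin I → A → Θ → ℝ} {B : ℝ} (hB : ∀ i a θ, |w i a θ| ≤ B)
    {a₀ : A} {i : Fin I} {s t : Θ} (h : normType w a₀ i s = normType w a₀ i t) (x : Outc A I) :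
    uT w i x s = uT w i x t + (w i a₀ s - w i a₀ t) := by
  have hs : (fun a => w i a s) = fun a => w i a t + (w i a₀ s - w i a₀ t) := by
    funext a
    have := congrFun h a
    simp only [normType] at this
    linarith
  simp only [uT, hs]
  rw [eu_add_const _ fun a => hB i a t]
  ring

theorem uT_le_iff_of_normType_eq {w : Fin I → A → Θ → ℝ} {B : ℝ} (hB : ∀ i a θ, |w i a θ| ≤ B)
    {a₀ : A} {i : Fin I} {s t : Θ} (h : normType w a₀ i s = normType w a₀ i t)
    (x y : Outc A I) : uT w i x s ≤ uT w i y s ↔ uT w i x t ≤ uT w i y t := by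
  rw [uT_eq_add_of_normType_eq hB h, uT_eq_add_of_normType_eq hB h, add_le_add_iff_right]

theorem uT_lt_iff_of_normType_eq {w : Fin I → A → Θ → ℝ} {B : ℝ} (hB : ∀ i a θ, |w i a θ| ≤ B)
    {a₀ : A} {i : Fin I} {s t : Θ} (h : normType w a₀ i s = normType w a₀ i t)
    (x y : Outc A I) : uT w i x s < uT w i y s ↔ uT w i x t < uT w i y t := by
  rw [uT_eq_add_of_normType_eq hB h, uT_eq_add_of_normType_eq hB h, add_lt_add_iff_right]

theorem uT_pure (w : Fin I → A → Θ → ℝ) (i : Fin I) (a : A) (r : Fin I → ℝ) (θ : Θ) :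
    uT w i (PMF.pure a, r) θ = w i a θ + r i := by
  simp only [uT, eu_pure]

/-- A menu of two outcomes from which `s` and `t` make different strict choices. -/
theorem exists_separating_menu (w : Fin I → A → Θ → ℝ) (a₀ : A) (i : Fin I) (s t : Θ) :
    ∃ y : Θ → Outc A I, (∀ θ θ', uT w i (y θ') θ ≤ uT w i (y θ) θ) ∧
      (normType w a₀ i s ≠ normType w a₀ i t → uT w i (y t) s < uT w i (y s) s) := by
  by_cases h : normType w a₀ i s = normType w a₀ i t
  · exact ⟨fun _ => (PMF.pure a₀, 0), fun _ _ => le_rfl, fun h' => absurd h h'⟩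
  obtain ⟨a, ha⟩ := Function.ne_iff.1 h
  set p := (normType w a₀ i s a + normType w a₀ i t a) / 2 with hp
  refine ⟨fun θ => if p < normType w a₀ i θ a then (PMF.pure a, fun _ => -p)
    else (PMF.pure a₀, 0), fun θ θ' => ?_, fun _ => ?_⟩
  · dsimp only
    split_ifs with h1 h2 h2 <;> simp only [uT_pure, normType, Pi.zero_apply] at * <;> linarith
  · dsimp only
    simp only [normType] at ha hp
    rcases lt_or_gt_of_ne ha with h' | h'
    · rw [if_pos, if_neg] <;> simp only [uT_pure, normType, Pi.zero_apply] <;> linarith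
    · rw [if_neg, if_pos] <;> simp only [uT_pure, normType, Pi.zero_apply] <;> linarith

/-- Dictator outcomes: agent `i` strictly prefers the one designed for the true type. -/
theorem exists_dictator_outcomes [Fintype Θ] (w : Fin I → A → Θ → ℝ) {B : ℝ}
    (hB : ∀ i a θ, |w i a θ| ≤ B) (a₀ : A) (i : Fin I) :
    ∃ y : Θ → Outc A I, (∀ θ θ', uT w i (y θ') θ ≤ uT w i (y θ) θ) ∧
      ∀ θ θ', normType w a₀ i θ ≠ normType w a₀ i θ' → uT w i (y θ') θ < uT w i (y θ) θ := by
  rcases isEmpty_or_nonempty Θ with hΘ | hΘ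
  · exact ⟨fun _ => (PMF.pure a₀, 0), fun θ => hΘ.elim θ, fun θ => hΘ.elim θ⟩
  choose z hz hz' using fun p : Θ × Θ => exists_separating_menu w a₀ i p.1 p.2
  choose y hy using fun θ : Θ => exists_average w hB fun p : Θ × Θ => z p θ
  have hc : (0 : ℝ) < (Fintype.card (Θ × Θ) : ℝ)⁻¹ :=
    inv_pos.2 (by exact_mod_cast Fintype.card_pos)
  refine ⟨y, fun θ θ' => ?_, fun θ θ' h => ?_⟩
  · rw [hy, hy]
    exact mul_le_mul_of_nonneg_left (Finset.sum_le_sum fun p _ => hz p θ θ') hc.le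
  · rw [hy, hy]
    exact mul_lt_mul_of_pos_left (Finset.sum_lt_sum (fun p _ => hz p θ θ')
      ⟨(θ, θ'), Finset.mem_univ _, hz' (θ, θ') h⟩) hc

/-- Agent `j` of type `t` can effectively challenge the outcome `f s` prescribed at `s`. -/
def CanChallenge (w : Fin I → A → Θ → ℝ) (f : Θ → Outc A I) (j : Fin I) (s t : Θ) : Prop :=
  ∃ z : Outc A I, uT w j z s ≤ uT w j (f s) s ∧ uT w j (f s) t < uT w j z t

theorem CanChallenge.of_normType_eq {w : Fin I → A → Θ → ℝ} {B : ℝ}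
    (hB : ∀ i a θ, |w i a θ| ≤ B) {a₀ : A} {f : Θ → Outc A I} {j : Fin I} {s t t' : Θ}
    (h : normType w a₀ j t = normType w a₀ j t') (hc : CanChallenge w f j s t) :
    CanChallenge w f j s t' := by
  obtain ⟨z, hz, hz'⟩ := hc
  exact ⟨z, hz, (uT_lt_iff_of_normType_eq hB h _ _).1 hz'⟩

theorem not_canChallenge_of_normType_eq {w : Fin I → A → Θ → ℝ} {B : ℝ}
    (hB : ∀ i a θ, |w i a θ| ≤ B) {a₀ : A} {f : Θ → Outc A I} {j : Fin I} {s t : Θ}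
    (h : normType w a₀ j s = normType w a₀ j t) : ¬ CanChallenge w f j s t := by
  rintro ⟨z, hz, hz'⟩
  exact absurd ((uT_le_iff_of_normType_eq hB h _ _).1 hz) (not_le.2 hz')

/-- A best challenge scheme. -/
theorem exists_best_challenge [Finite Θ] (w : Fin I → A → Θ → ℝ) (f : Θ → Outc A I)
    (j : Fin I) (s : Θ) :
    ∃ x : Θ → Outc A I, (∀ t, ¬ CanChallenge w f j s t → x t = f s) ∧
      (∀ t, CanChallenge w f j s t → uT w j (f s) t < uT w j (x t) t) ∧
      ∀ t t', uT w j (x t') t ≤ uT w j (x t) t := by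
  have hz : ∀ t, ∃ z : Outc A I, uT w j z s ≤ uT w j (f s) s ∧
      (CanChallenge w f j s t → uT w j (f s) t < uT w j z t) := fun t => by
    by_cases h : CanChallenge w f j s t
    · obtain ⟨z, h1, h2⟩ := h
      exact ⟨z, h1, fun _ => h2⟩
    · exact ⟨f s, le_rfl, fun h' => absurd h' h⟩
  choose z hzl hzs using hz
  have : Nonempty Θ := ⟨s⟩
  choose b hb using fun t : Θ => Finite.exists_max fun t' => uT w j (z t') t
  have hpos : ∀ t, CanChallenge w f j s t → uT w j (f s) t < uT w j (z (b t)) t :=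
    fun t h => (hzs t h).trans_le (hb t t)
  refine ⟨fun t => if CanChallenge w f j s t then z (b t) else f s,
    fun t h => if_neg h, fun t h => ?_, fun t t' => ?_⟩
  · simpa only [if_pos h] using hpos t h
  · dsimp only
    split_ifs with h1 h2 h2
    · exact hb t (b t')
    · by_contra hlt
      exact h2 ⟨z (b t'), hzl _, not_le.1 hlt⟩
    · exact (hpos t h2).le
    · exact le_rfl

end Types

section Equilibrium

theorem expPayD_eq_sum_update [Fintype Θ] (w : Fin I → A → Θ → ℝ) (g : (Fin I → Θ) → Outc A I)
    (τ : Fin I → (Fin I → Θ) → ℝ) (θ : Θ) (σ : Fin I → Θ → ℝ) (i : Fin I) (s t : Θ) :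
    expPayD w g τ θ σ i t = ∑ m : Fin I → Θ, (∏ j ∈ Finset.univ.erase i, σ j (m j)) *
      (if m i = s then payoffD w g τ θ i (Function.update m i t) else 0) := by
  simp only [expPayD, mul_ite, mul_zero]
  rw [← Finset.sum_filter, ← Finset.sum_filter]
  refine Finset.sum_nbij' (fun m => Function.update m i s) (fun m => Function.update m i t)
    ?_ ?_ ?_ ?_ ?_
  · intro m _
    simp
  · intro m _
    simp
  · intro m hm
    simp only [Finset.mem_filter] at hm
    simp [← hm.2]
  · intro m hm
    simp only [Finset.mem_filter] at hm
    simp [← hm.2]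
  · intro m hm
    simp only [Finset.mem_filter] at hm
    simp only [Function.update_idem, ← hm.2, Function.update_eq_self]
    congr 1
    refine Finset.prod_congr rfl fun j hj => ?_
    rw [Function.update_of_ne (Finset.ne_of_mem_erase hj)]

/-- On the support of an equilibrium, no deviation weakly improves a message against all opposing
profiles in the support and strictly improves it against one of them. -/
theorem IsNED.update_le [Fintype Θ] {w : Fin I → A → Θ → ℝ} {g : (Fin I → Θ) → Outc A I}
    {τ : Fin I → (Fin I → Θ) → ℝ} {θ : Θ} {σ : Fin I → Θ → ℝ} (hσ : IsNED w g τ θ σ)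
    (i : Fin I) (m₀ : Fin I → Θ) (t : Θ) (hm₀ : ∀ j, 0 < σ j (m₀ j))
    (h : ∀ m : Fin I → Θ, (∀ j, 0 < σ j (m j)) → m i = m₀ i →
      payoffD w g τ θ i m ≤ payoffD w g τ θ i (Function.update m i t)) :
    payoffD w g τ θ i (Function.update m₀ i t) ≤ payoffD w g τ θ i m₀ := by
  by_contra! hlt
  refine absurd (hσ.2 i (m₀ i) (hm₀ i) t) (not_le.2 ?_)
  rw [expPayD_eq_sum_update w g τ θ σ i (m₀ i) t]
  refine Finset.sum_lt_sum (fun m _ => ?_) ⟨m₀, Finset.mem_univ _, ?_⟩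
  · have hnn : ∀ j ∈ Finset.univ.erase i, 0 ≤ σ j (m j) := fun j _ => (hσ.1 j).1 _
    by_cases hmi : m i = m₀ i
    · by_cases hz : ∏ j ∈ Finset.univ.erase i, σ j (m j) = 0
      · simp [hz]
      · rw [if_pos hmi, if_pos hmi]
        refine mul_le_mul_of_nonneg_left (h m (fun j => ?_) hmi) (Finset.prod_nonneg hnn)
        by_cases hji : j = i
        · subst hji
          rw [hmi]
          exact hm₀ j
        · have hj : j ∈ Finset.univ.erase i := Finset.mem_erase.2 ⟨hji, Finset.mem_univ _⟩
          exact lt_of_le_of_ne (hnn j hj) (Ne.symm (Finset.prod_ne_zero_iff.1 hz j hj))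
    · simp [hmi]
  · rw [if_pos rfl, if_pos rfl]
    exact mul_lt_mul_of_pos_left hlt (Finset.prod_pos fun j _ => hm₀ j)

end Equilibrium

section Reports

variable {V : Type}

/-- All agents other than `k` predict the same type of agent `k`. -/
def Agree (c : Fin I → Θ → V) (k : Fin I) (m : Fin I → Θ) : Prop :=
  ∀ i j, i ≠ k → j ≠ k → c k (m i) = c k (m j)

/-- The predictions about every agent agree. -/
def Consistent (c : Fin I → Θ → V) (m : Fin I → Θ) : Prop := ∀ k, Agree c k m

/-- Whenever the predictions about `k` disagree, those that match `k`'s own report are rewarded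
and the others are fined. -/
def predictionTransfer (c : Fin I → Θ → V) (P : ℝ) (i : Fin I) (m : Fin I → Θ) : ℝ :=
  ∑ k ∈ Finset.univ.erase i,
    if Agree c k m then 0 else if c k (m i) = c k (m k) then P else -P

theorem exists_ne_ne (hI : 3 ≤ I) (i k : Fin I) : ∃ l : Fin I, l ≠ i ∧ l ≠ k := by
  have hlt : ({i, k} : Finset (Fin I)).card < (Finset.univ : Finset (Fin I)).card := by
    rw [Finset.card_univ, Fintype.card_fin]
    exact lt_of_le_of_lt Finset.card_le_two hI
  obtain ⟨l, -, hl⟩ := Finset.exists_mem_notMem_of_card_lt_card hlt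
  simp only [Finset.mem_insert, Finset.mem_singleton, not_or] at hl
  exact ⟨l, hl⟩

theorem agree_congr {c : Fin I → Θ → V} {k : Fin I} {m m' : Fin I → Θ}
    (h : ∀ i, i ≠ k → c k (m i) = c k (m' i)) : Agree c k m ↔ Agree c k m' := by
  constructor <;> intro ha i j hi hj
  · rw [← h i hi, ← h j hj, ha i j hi hj]
  · rw [h i hi, h j hj, ha i j hi hj]

theorem consistent_congr {c : Fin I → Θ → V} {m m' : Fin I → Θ}
    (h : ∀ k i, i ≠ k → c k (m i) = c k (m' i)) : Consistent c m ↔ Consistent c m' :=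
  forall_congr' fun k => agree_congr (h k)

theorem eq_update_of_eq {c : Fin I → Θ → V} {k i : Fin I} {m : Fin I → Θ} {t : Θ}
    (h : c k t = c k (m i)) (l : Fin I) : c k (m l) = c k (Function.update m i t l) := by
  by_cases hl : l = i
  · subst hl
    rw [Function.update_self, h]
  · rw [Function.update_of_ne hl]

theorem eq_update_of_forall {c : Fin I → Θ → V} {i : Fin I} {m : Fin I → Θ} {t : Θ}
    (h : ∀ k, k ≠ i → c k t = c k (m i)) (k l : Fin I) (hl : l ≠ k) :
    c k (m l) = c k (Function.update m i t l) := by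
  by_cases hk : k = i
  · subst hk
    rw [Function.update_of_ne hl]
  · exact eq_update_of_eq (h k hk) l

theorem predictionTransfer_eq_zero {c : Fin I → Θ → V} {P : ℝ} {m : Fin I → Θ}
    (h : Consistent c m) (i : Fin I) : predictionTransfer c P i m = 0 :=
  Finset.sum_eq_zero fun k _ => if_pos (h k)

theorem predictionTransfer_update_own {c : Fin I → Θ → V} {P : ℝ} {i : Fin I} {m : Fin I → Θ}
    {t : Θ} (h : ∀ k, k ≠ i → c k t = c k (m i)) :
    predictionTransfer c P i (Function.update m i t) = predictionTransfer c P i m := by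
  refine Finset.sum_congr rfl fun k hk => ?_
  have hki := Finset.ne_of_mem_erase hk
  rw [← agree_congr fun l _ => eq_update_of_eq (h k hki) l, Function.update_self,
    Function.update_of_ne hki, h k hki]

/-- Correcting a wrong prediction raises the transfer by at least `P`. -/
theorem predictionTransfer_add_le (hI : 3 ≤ I) {c : Fin I → Θ → V} {P : ℝ} (hP : 0 ≤ P)
    {i k : Fin I} (hki : k ≠ i) {m : Fin I → Θ} {t : Θ} (hne : c k (m i) ≠ c k (m k))
    (ht : c k t = c k (m k)) (h : ∀ l, l ≠ k → c l t = c l (m i)) :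
    predictionTransfer c P i m + P ≤ predictionTransfer c P i (Function.update m i t) := by
  have hk : k ∈ Finset.univ.erase i := Finset.mem_erase.2 ⟨hki, Finset.mem_univ _⟩
  simp only [predictionTransfer]
  rw [← Finset.add_sum_erase _ _ hk, ← Finset.add_sum_erase _ _ hk]
  have hrest : ∀ l ∈ (Finset.univ.erase i).erase k,
      (if Agree c l m then 0 else if c l (m i) = c l (m l) then P else -P) =
      (if Agree c l (Function.update m i t) then 0 else
        if c l (Function.update m i t i) = c l (Function.update m i t l) then P else -P) := by
    intro l hl
    have hlk := Finset.ne_of_mem_erase hl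
    have hli := Finset.ne_of_mem_erase (Finset.mem_of_mem_erase hl)
    rw [← agree_congr fun j _ => eq_update_of_eq (h l hlk) j, Function.update_self,
      Function.update_of_ne hli, h l hlk]
  rw [Finset.sum_congr rfl hrest]
  obtain ⟨l, hli, hlk⟩ := exists_ne_ne hI i k
  have hnot : Agree c k m → ¬ Agree c k (Function.update m i t) := by
    intro h1 h2
    have e1 := h1 i l hki.symm hlk
    have e2 := h2 i l hki.symm hlk
    rw [Function.update_self, Function.update_of_ne hli, ht] at e2
    exact hne (e1.trans e2.symm)
  rw [Function.update_self, Function.update_of_ne hki, if_neg hne, if_pos ht]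
  split_ifs with h1 h2 h2
  · exact absurd h2 (hnot h1)
  all_goals linarith

/-- A single agent with a wrong prediction about `k` against unanimous truthful reports is fined. -/
theorem predictionTransfer_update_const_le (hI : 3 ≤ I) {c : Fin I → Θ → V} {P : ℝ} (hP : 0 ≤ P)
    {i k : Fin I} (hki : k ≠ i) {θ t : Θ} (hne : c k t ≠ c k θ) :
    predictionTransfer c P i (Function.update (fun _ => θ) i t) ≤ -P := by
  have hk : k ∈ Finset.univ.erase i := Finset.mem_erase.2 ⟨hki, Finset.mem_univ _⟩
  obtain ⟨l, hli, hlk⟩ := exists_ne_ne hI i k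
  have hagree : ¬ Agree c k (Function.update (fun _ => θ) i t) := fun h => hne <| by
    simpa [hli] using h i l hki.symm hlk
  rw [predictionTransfer, ← Finset.add_sum_erase _ _ hk, if_neg hagree, Function.update_self,
    Function.update_of_ne hki, if_neg hne]
  refine add_le_of_nonpos_right (Finset.sum_nonpos fun j hj => ?_)
  have hji := Finset.ne_of_mem_erase (Finset.mem_of_mem_erase hj)
  rw [Function.update_of_ne hji]
  split_ifs with h1 h2
  · exact le_rfl
  · exact absurd ((agree_congr fun n _ => eq_update_of_eq (m := fun _ => θ) h2 n).1
      fun _ _ _ _ => rfl) h1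
  · exact neg_nonpos.2 hP

/-- The message profile is consistent and no report challenges the consensus. -/
def Quiet (c : Fin I → Θ → V) (st : (Fin I → Θ) → Θ) (E : Fin I → Θ → Θ → Prop)
    (m : Fin I → Θ) : Prop :=
  Consistent c m ∧ ∀ k, ¬ E k (st m) (m k)

/-- If reporting the own type truthfully is weakly dominant, with a strict gain outside quiet
unchallengeable profiles, and fines for wrong predictions exceed all outcome stakes, then only
quiet unchallengeable profiles survive. -/
theorem quiet_of_undominated (hI : 3 ≤ I) {c : Fin I → Θ → V}
    (hprod : ∀ s : Fin I → Θ, ∃ θ, ∀ k, c k θ = c k (s k))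
    {st : (Fin I → Θ) → Θ}
    (hstc : ∀ m m' : Fin I → Θ, (∀ k i, i ≠ k → c k (m i) = c k (m' i)) → st m = st m')
    (hst : ∀ m, Consistent c m → ∀ k i, i ≠ k → c k (m i) = c k (st m))
    {E : Fin I → Θ → Θ → Prop}
    (hE : ∀ k s t t', c k t = c k t' → E k s t → E k s t')
    (hE' : ∀ k s t, c k s = c k t → ¬ E k s t)
    {θ : Θ} {v : Fin I → (Fin I → Θ) → ℝ} {L P : ℝ}
    (hL : ∀ i m m', v i m - v i m' ≤ L) (hP : L < P)
    (hweak : ∀ j m t, c j t = c j θ → (∀ k, k ≠ j → c k t = c k (m j)) →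
      v j m ≤ v j (Function.update m j t))
    (hstrict : ∀ j m t, c j t = c j θ → (∀ k, k ≠ j → c k t = c k (m j)) →
      c j (m j) ≠ c j θ → ¬ (Quiet c st E m ∧ ¬ E j (st m) θ) →
      v j m < v j (Function.update m j t))
    {S : Fin I → Set Θ}
    (hS : ∀ (i : Fin I) (m₀ : Fin I → Θ) (t : Θ), (∀ j, m₀ j ∈ S j) →
      (∀ m : Fin I → Θ, (∀ j, m j ∈ S j) → m i = m₀ i →
        v i m + predictionTransfer c P i m ≤ v i (Function.update m i t) +
          predictionTransfer c P i (Function.update m i t)) →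
      v i (Function.update m₀ i t) + predictionTransfer c P i (Function.update m₀ i t) ≤
        v i m₀ + predictionTransfer c P i m₀)
    (m : Fin I → Θ) (hm : ∀ j, m j ∈ S j) :
    Quiet c st E m ∧ ∀ k, ¬ E k (st m) θ := by
  have hfalse : ∀ m : Fin I → Θ, (∀ j, m j ∈ S j) → ∀ j, c j (m j) ≠ c j θ →
      Quiet c st E m ∧ ¬ E j (st m) θ := by
    intro m hm j hj
    by_contra hq
    obtain ⟨t, ht⟩ := hprod (Function.update (fun _ => m j) j θ)
    have ht1 : c j t = c j θ := by simpa using ht j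
    have ht2 : ∀ k, k ≠ j → c k t = c k (m j) := fun k hk => by simpa [hk] using ht k
    have := hS j m t hm fun m' hm' hmj => by
      rw [← hmj] at ht2
      rw [predictionTransfer_update_own ht2]
      linarith [hweak j m' t ht1 ht2]
    rw [predictionTransfer_update_own ht2] at this
    linarith [hstrict j m t ht1 ht2 hj hq]
  have hpred : ∀ i k, k ≠ i → (∀ m : Fin I → Θ, (∀ j, m j ∈ S j) → c k (m k) = c k θ) →
      ∀ m : Fin I → Θ, (∀ j, m j ∈ S j) → c k (m i) = c k θ := by
    intro i k hki htrue m hm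
    by_contra hne
    obtain ⟨t, ht⟩ := hprod (Function.update (fun _ => m i) k θ)
    have ht1 : c k t = c k θ := by simpa using ht k
    have ht2 : ∀ l, l ≠ k → c l t = c l (m i) := fun l hl => by simpa [hl] using ht l
    have hP0 : 0 ≤ P := by linarith [hL i m m]
    have key : ∀ m' : Fin I → Θ, (∀ j, m' j ∈ S j) → m' i = m i →
        v i m' + predictionTransfer c P i m' < v i (Function.update m' i t) +
          predictionTransfer c P i (Function.update m' i t) := by
      intro m' hm' hmi
      have hk := htrue m' hm'
      have := predictionTransfer_add_le hI hP0 hki (m := m') (t := t)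
        (by rwa [hk, hmi]) (ht1.trans hk.symm) (by rwa [hmi])
      linarith [hL i m' (Function.update m' i t)]
    exact absurd (hS i m t hm fun m' hm' hmi => (key m' hm' hmi).le) (not_le.2 (key m hm rfl))
  have hupd : ∀ m m' : Fin I → Θ, (∀ j, m j ∈ S j) → (∀ j, m' j ∈ S j) → ∀ i,
      ∀ j, Function.update m i (m' i) j ∈ S j := by
    intro m m' hm hm' i j
    by_cases h : j = i
    · subst h
      simpa using hm' j
    · simpa [h] using hm j
  by_cases hall : ∀ m : Fin I → Θ, (∀ j, m j ∈ S j) → ∀ k, c k (m k) = c k θ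
  · have hp : ∀ k i, c k (m i) = c k θ := fun k i => by
      by_cases hki : k = i
      · subst hki
        exact hall m hm k
      · exact hpred i k hki (fun m' hm' => hall m' hm' k) m hm
    have hc : Consistent c m := fun k i j _ _ => (hp k i).trans (hp k j).symm
    have hs : ∀ k, c k (st m) = c k θ := fun k => by
      obtain ⟨l, hl, -⟩ := exists_ne_ne hI k k
      rw [← hst m hc k l hl, hp k l]
    exact ⟨⟨hc, fun k => hE' k _ _ ((hs k).trans (hp k k).symm)⟩, fun k => hE' k _ _ (hs k)⟩
  push Not at hall
  obtain ⟨m₀, hm₀, j, hj⟩ := hall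
  obtain ⟨hq₀, hej⟩ := hfalse m₀ hm₀ j hj
  have hcs := hst m₀ hq₀.1
  have hquiet : ∀ m : Fin I → Θ, (∀ j, m j ∈ S j) → ∀ i, i ≠ j →
      Quiet c st E (Function.update m₀ i (m i)) := by
    intro m hm i hij
    refine (hfalse _ (hupd m₀ m hm₀ hm i) j ?_).1
    rwa [Function.update_of_ne hij.symm]
  have hother : ∀ m : Fin I → Θ, (∀ j, m j ∈ S j) → ∀ i, i ≠ j → ∀ k, i ≠ k →
      c k (m i) = c k (st m₀) := by
    intro m hm i hij k hik
    obtain ⟨l, hli, hlk⟩ := exists_ne_ne hI i k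
    have := (hquiet m hm i hij).1 k i l hik hlk
    rw [Function.update_self, Function.update_of_ne hli] at this
    rw [this, hcs k l hlk]
  have hown : ∀ m : Fin I → Θ, (∀ j, m j ∈ S j) → ∀ k, j ≠ k → c k (m j) = c k (st m₀) := by
    intro m hm k hjk
    by_contra hne
    have htrue : ∀ m' : Fin I → Θ, (∀ j, m' j ∈ S j) → c k (m' k) = c k θ := by
      intro m' hm'
      by_contra hk
      have hq := (hfalse _ (hupd m' m hm' hm j) k (by
        rwa [Function.update_of_ne hjk.symm])).1.1
      obtain ⟨l, hlj, hlk⟩ := exists_ne_ne hI j k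
      have := hq k j l hjk hlk
      rw [Function.update_self, Function.update_of_ne hlj, hother m' hm' l hlj k hlk] at this
      exact hne this
    rw [hpred j k hjk.symm htrue m hm, ← hpred j k hjk.symm htrue m₀ hm₀] at hne
    exact hne (hcs k j hjk)
  have hpr : ∀ k i, i ≠ k → c k (m i) = c k (st m₀) := by
    intro k i hik
    by_cases hij : i = j
    · subst hij
      exact hown m hm k hik
    · exact hother m hm i hij k hik
  have hsm : st m = st m₀ := hstc _ _ fun k i hik => by rw [hpr k i hik, hcs k i hik]
  have hnE : ∀ k, ¬ E k (st m₀) θ := by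
    intro k
    by_cases hk : c k (m₀ k) = c k θ
    · exact fun h => hq₀.2 k (hE k _ _ _ hk.symm h)
    · exact (hfalse m₀ hm₀ k hk).2
  rw [hsm]
  refine ⟨⟨fun k i l hi hl => by rw [hpr k i hi, hpr k l hl], fun k => ?_⟩, hnE⟩
  rw [hsm]
  by_cases hk : c k (m k) = c k θ
  · exact fun h => hnE k (hE k _ _ _ hk h)
  · rw [← hsm]
    exact (hfalse m hm k hk).1.2 k

end Reports

section Construction

theorem exists_forall_le {ι : Type} [Finite ι] (F : ι → ℝ) : ∃ M, ∀ k, F k ≤ M := by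
  obtain ⟨M, hM⟩ := (Set.finite_range F).bddAbove
  exact ⟨M, fun k => hM ⟨k, rfl⟩⟩

theorem exists_small_weight {ι : Type} [Finite ι] (F G D : ι → ℝ) :
    ∃ ε : ℝ, 0 < ε ∧ ε < 1 ∧ ∀ k, F k < G k → F k < (1 - ε) * G k + ε * D k := by
  have h : ∀ᶠ ε : ℝ in nhdsWithin 0 (Set.Ioi 0),
      ∀ k, F k < G k → F k < (1 - ε) * G k + ε * D k := by
    refine Filter.eventually_all.2 fun k => ?_
    by_cases hk : F k < G k
    · have hcont : Continuous fun ε : ℝ => (1 - ε) * G k + ε * D k := by fun_prop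
      have h0 := (hcont.tendsto 0).eventually_const_lt (u := F k) (by simpa using hk)
      exact (h0.filter_mono nhdsWithin_le_nhds).mono fun _ h _ => h
    · exact Filter.Eventually.of_forall fun _ h => absurd h hk
  obtain ⟨ε, h1, h2⟩ := (h.and (Ioo_mem_nhdsGT (zero_lt_one' ℝ))).exists
  exact ⟨ε, h2.1, h2.2, h1⟩

/-- The outcome functions of the implementing mechanisms: consistent reports yield the consensus
outcome unless some agent challenges it, and truthful reports of own types are dominant. -/
theorem exists_outcome_function [Fintype Θ] (w : Fin I → A → Θ → ℝ) {B : ℝ}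
    (hB : ∀ i a θ, |w i a θ| ≤ B) (a₀ : A) (f : Θ → Outc A I) [Nonempty (Fin I)]
    {st : (Fin I → Θ) → Θ}
    (hstc : ∀ m m' : Fin I → Θ,
      (∀ k i, i ≠ k → normType w a₀ k (m i) = normType w a₀ k (m' i)) → st m = st m') :
    ∃ g : (Fin I → Θ) → Outc A I,
      (∀ m, Quiet (normType w a₀) st (CanChallenge w f) m → g m = f (st m)) ∧
      ∀ θ j m t, normType w a₀ j t = normType w a₀ j θ →
        (∀ k, k ≠ j → normType w a₀ k t = normType w a₀ k (m j)) →
        uT w j (g m) θ ≤ uT w j (g (Function.update m j t)) θ ∧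
        (normType w a₀ j (m j) ≠ normType w a₀ j θ →
          ¬ (Quiet (normType w a₀) st (CanChallenge w f) m ∧ ¬ CanChallenge w f j (st m) θ) →
          uT w j (g m) θ < uT w j (g (Function.update m j t)) θ) := by
  choose x hx0 hx1 hx2 using exists_best_challenge w f
  choose y hy hy' using exists_dictator_outcomes w hB a₀
  choose X hX using fun (s : Θ) (m : Fin I → Θ) =>
    exists_average w hB fun k => x k s (m k)
  choose D₀ hD₀ using fun m : Fin I → Θ => exists_average w hB fun k => y k (m k)
  obtain ⟨M, hM⟩ := exists_forall_le fun p : Fin I × Θ × Θ × (Fin I → Θ) =>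
    uT w p.1 (D₀ p.2.2.2) p.2.1 - uT w p.1 (f p.2.2.1) p.2.1
  obtain ⟨D, hD⟩ : ∃ D : (Fin I → Θ) → Outc A I,
      ∀ i m θ, uT w i (D m) θ = uT w i (D₀ m) θ - (M + 1) :=
    ⟨fun m => ((D₀ m).1, fun i => (D₀ m).2 i - (M + 1)), fun i m θ => by
      simp only [uT]; ring⟩
  have hDf : ∀ i m s θ, uT w i (D m) θ < uT w i (f s) θ := fun i m s θ => by
    have := hM (i, θ, s, m)
    rw [hD]
    dsimp only at this
    linarith
  obtain ⟨ε, hε0, hε1, hε⟩ := exists_small_weight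
    (fun p : Fin I × Θ × Θ × (Fin I → Θ) => uT w p.1 (f p.2.2.1) p.2.1)
    (fun p => uT w p.1 (X p.2.2.1 p.2.2.2) p.2.1) (fun p => uT w p.1 (D p.2.2.2) p.2.1)
  choose Z hZ using fun (s : Θ) (m : Fin I → Θ) =>
    exists_binary_mixture w hB hε0.le hε1.le (X s m) (D m)
  have hcard : (0 : ℝ) < (Fintype.card (Fin I) : ℝ)⁻¹ :=
    inv_pos.2 (by exact_mod_cast Fintype.card_pos)
  have hconst : ∀ r : ℝ, (Fintype.card (Fin I) : ℝ)⁻¹ * ∑ _k : Fin I, r = r := fun r => by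
    rw [Finset.sum_const, nsmul_eq_mul, ← mul_assoc, Finset.card_univ,
      inv_mul_cancel₀ (inv_pos.1 hcard).ne', one_mul]
  refine ⟨fun m => if Consistent (normType w a₀) m then
    if ∃ k, CanChallenge w f k (st m) (m k) then Z (st m) m else f (st m) else D m,
    fun m hq => ?_, fun θ j m t ht hpt => ?_⟩
  · dsimp only
    rw [if_pos hq.1, if_neg (not_exists.2 hq.2)]
  have hsame := eq_update_of_forall hpt
  have hst : st (Function.update m j t) = st m := (hstc _ _ hsame).symm
  have hcon := consistent_congr (c := normType w a₀) hsame
  set m' := Function.update m j t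
  have hmj : m' j = t := Function.update_self ..
  have hmk : ∀ k, k ≠ j → m' k = m k := fun k hk => Function.update_of_ne hk ..
  have hyk : ∀ k, uT w j (y k (m k)) θ ≤ uT w j (y k (m' k)) θ := fun k => by
    by_cases hk : k = j
    · subst hk
      rw [hmj]
      exact (uT_le_iff_of_normType_eq hB ht _ _).1 (hy k t (m k))
    · rw [hmk k hk]
  have hDle : uT w j (D m) θ ≤ uT w j (D m') θ := by
    rw [hD, hD, hD₀, hD₀, sub_le_sub_iff_right]
    exact mul_le_mul_of_nonneg_left (Finset.sum_le_sum fun k _ => hyk k) hcard.le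
  have hDlt : normType w a₀ j (m j) ≠ normType w a₀ j θ → uT w j (D m) θ < uT w j (D m') θ := by
    intro hne
    rw [hD, hD, hD₀, hD₀, sub_lt_sub_iff_right]
    refine mul_lt_mul_of_pos_left (Finset.sum_lt_sum (fun k _ => hyk k)
      ⟨j, Finset.mem_univ _, ?_⟩) hcard
    rw [hmj]
    exact (uT_lt_iff_of_normType_eq hB ht _ _).1 (hy' j t (m j) fun h => hne (h.symm.trans ht))
  dsimp only
  rw [← hcon, hst]
  by_cases hc : Consistent (normType w a₀) m
  swap
  · rw [if_neg hc, if_neg hc]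
    exact ⟨hDle, fun hne _ => hDlt hne⟩
  rw [if_pos hc, if_pos hc]
  have hxj : ∀ s, uT w j (x j s (m j)) θ ≤ uT w j (x j s t) θ := fun s =>
    (uT_le_iff_of_normType_eq hB ht _ _).1 (hx2 j s t (m j))
  by_cases h : ∃ k, CanChallenge w f k (st m) (m k) <;>
    by_cases h' : ∃ k, CanChallenge w f k (st m) (m' k)
  · rw [if_pos h, if_pos h', hZ, hZ]
    have hXle : uT w j (X (st m) m) θ ≤ uT w j (X (st m) m') θ := by
      rw [hX, hX]
      refine mul_le_mul_of_nonneg_left (Finset.sum_le_sum fun k _ => ?_) hcard.le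
      by_cases hk : k = j
      · subst hk
        rw [hmj]
        exact hxj _
      · rw [hmk k hk]
    have h1 := mul_le_mul_of_nonneg_left hXle (sub_nonneg.2 hε1.le)
    exact ⟨add_le_add h1 (mul_le_mul_of_nonneg_left hDle hε0.le),
      fun hne _ => add_lt_add_of_le_of_lt h1 (mul_lt_mul_of_pos_left (hDlt hne) hε0)⟩
  · rw [if_pos h, if_neg h', hZ]
    push Not at h'
    have hXle : uT w j (X (st m) m) θ ≤ uT w j (f (st m)) θ := by
      rw [hX, ← hconst (uT w j (f (st m)) θ)]
      refine mul_le_mul_of_nonneg_left (Finset.sum_le_sum fun k _ => ?_) hcard.le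
      have hxf := hx0 k (st m) (m' k) (h' k)
      by_cases hk : k = j
      · subst hk
        rw [hmj] at hxf
        rw [← hxf]
        exact hxj _
      · rw [hmk k hk] at hxf
        rw [hxf]
    have hlt : (1 - ε) * uT w j (X (st m) m) θ + ε * uT w j (D m) θ < uT w j (f (st m)) θ := by
      have h1 := mul_le_mul_of_nonneg_left hXle (sub_nonneg.2 hε1.le)
      have h2 := mul_lt_mul_of_pos_left (hDf j m (st m) θ) hε0
      linarith
    exact ⟨hlt.le, fun _ _ => hlt⟩
  · rw [if_neg h, if_pos h', hZ]
    push Not at h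
    have hjt : CanChallenge w f j (st m) t := by
      obtain ⟨k, hk⟩ := h'
      by_cases hkj : k = j
      · subst hkj
        rwa [hmj] at hk
      · rw [hmk k hkj] at hk
        exact absurd hk (h k)
    have hXlt : uT w j (f (st m)) θ < uT w j (X (st m) m') θ := by
      have hj := (uT_lt_iff_of_normType_eq hB ht _ _).1 (hx1 j (st m) t hjt)
      rw [hX]
      conv_lhs => rw [← hconst (uT w j (f (st m)) θ)]
      refine mul_lt_mul_of_pos_left (Finset.sum_lt_sum (fun k _ => ?_)
        ⟨j, Finset.mem_univ _, by rwa [hmj]⟩) hcard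
      by_cases hk : k = j
      · subst hk
        rw [hmj]
        exact hj.le
      · rw [hmk k hk, hx0 k (st m) (m k) (h k)]
    have hlt := hε (j, θ, st m, m') hXlt
    exact ⟨hlt.le, fun _ _ => hlt⟩
  · rw [if_neg h, if_neg h']
    refine ⟨le_rfl, fun _ hq => absurd ⟨⟨hc, not_exists.1 h⟩, fun hj => h' ⟨j, ?_⟩⟩ hq⟩
    rw [hmj]
    exact hj.of_normType_eq hB ht.symm

end Construction

/-- **Proposition 2**: with at least three agents and a product state space
(θ ↦ (θ_i)_{i∈𝓘} a bijection from Θ onto ×_i Θ_i), every Maskin-monotonic SCF is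
implementable in mixed-strategy Nash equilibria by a direct mechanism. -/
theorem mixed_implementable_by_direct_mechanism
    [Fintype Θ] [Nonempty A] (hI : 3 ≤ I)
    (w : Fin I → A → Θ → ℝ) (B : ℝ) (hB : ∀ i a θ, |w i a θ| ≤ B)
    (hinj : Function.Injective (fun (θ : Θ) (i : Fin I) => typeOf w i θ))
    (hsurj : ∀ t : Fin I → (A → ℝ), (∀ i, t i ∈ Set.range (typeOf w i)) →
      ∃ θ : Θ, (fun i => typeOf w i θ) = t)
    (f : Θ → Outc A I) (hf : MaskinMonotone w f) :
    ∃ (g : (Fin I → Θ) → Outc A I) (τ : Fin I → (Fin I → Θ) → ℝ),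
      (∀ θ : Θ, g (fun _ => θ) = f θ ∧ ∀ i, τ i (fun _ => θ) = 0) ∧
      ∀ θ : Θ,
        (∃ m, IsPureNED w g τ θ m) ∧
        ∀ m, InSuppNED w g τ θ m → g m = f θ ∧ ∀ i, τ i m = 0 := by
  rcases isEmpty_or_nonempty Θ with hΘ | hΘ
  · have hI0 : 0 < I := by omega
    exact ⟨fun m => hΘ.elim (m ⟨0, hI0⟩), fun _ _ => 0, fun θ => hΘ.elim θ, fun θ => hΘ.elim θ⟩
  have : Nonempty (Fin I) := ⟨⟨0, by omega⟩⟩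
  obtain ⟨a₀⟩ := ‹Nonempty A›
  have hprod : ∀ s : Fin I → Θ, ∃ θ, ∀ k, normType w a₀ k θ = normType w a₀ k (s k) := by
    intro s
    obtain ⟨θ, hθ⟩ := hsurj (fun k => typeOf w k (s k)) fun k => ⟨s k, rfl⟩
    refine ⟨θ, fun k => ?_⟩
    have hk : ∀ a, w k a θ = w k a (s k) := fun a => congrFun (congrFun hθ k) a
    funext a
    simp only [normType, hk]
  choose nx hnx _ using fun k : Fin I => exists_ne_ne hI k k
  obtain ⟨st, hst_def⟩ : ∃ st : (Fin I → Θ) → Θ, ∀ m, st m = Function.invFun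
      (fun θ k => normType w a₀ k θ) fun k => normType w a₀ k (m (nx k)) := ⟨_, fun _ => rfl⟩
  have hstc : ∀ m m' : Fin I → Θ,
      (∀ k i, i ≠ k → normType w a₀ k (m i) = normType w a₀ k (m' i)) → st m = st m' := by
    intro m m' h
    rw [hst_def, hst_def]
    congr 1
    funext k
    exact h k (nx k) (hnx k)
  have hstn : ∀ m k, normType w a₀ k (st m) = normType w a₀ k (m (nx k)) := by
    intro m k
    obtain ⟨θ, hθ⟩ := hprod fun k => m (nx k)
    rw [hst_def]
    exact congrFun (Function.invFun_eq (f := fun θ k => normType w a₀ k θ) ⟨θ, funext hθ⟩) k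
  have hst : ∀ m, Consistent (normType w a₀) m →
      ∀ k i, i ≠ k → normType w a₀ k (m i) = normType w a₀ k (st m) := fun m hm k i hik => by
    rw [hstn, hm k i (nx k) hik (hnx k)]
  have hfst : ∀ s θ, (∀ k, ¬ CanChallenge w f k s θ) → f s = f θ := by
    intro s θ h
    by_contra hne
    obtain ⟨i, x, h1, h2⟩ := hf s θ hne
    exact h i ⟨x, h1, h2⟩
  obtain ⟨g, hgq, hg⟩ := exists_outcome_function w hB a₀ f hstc
  obtain ⟨L, hL⟩ := exists_forall_le fun p : Θ × Fin I × (Fin I → Θ) × (Fin I → Θ) =>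
    uT w p.2.1 (g p.2.2.1) p.1 - uT w p.2.1 (g p.2.2.2) p.1
  have hquiet : ∀ θ : Θ, Quiet (normType w a₀) st (CanChallenge w f) fun _ => θ := fun θ =>
    ⟨fun k i j _ _ => rfl, fun k => not_canChallenge_of_normType_eq hB (hstn _ k)⟩
  have hgθ : ∀ θ : Θ, g (fun _ => θ) = f θ := fun θ =>
    (hgq _ (hquiet θ)).trans (hfst _ _ (hquiet θ).2)
  refine ⟨g, predictionTransfer (normType w a₀) (L + 1), fun θ =>
    ⟨hgθ θ, predictionTransfer_eq_zero (hquiet θ).1⟩, fun θ => ⟨⟨fun _ => θ, ?_⟩, ?_⟩⟩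
  · intro i t
    simp only [payoffD, predictionTransfer_eq_zero (hquiet θ).1]
    have hL0 : 0 ≤ L := by simpa using hL (θ, i, fun _ => θ, fun _ => θ)
    by_cases ht : ∀ k, k ≠ i → normType w a₀ k t = normType w a₀ k θ
    · rw [predictionTransfer_update_own ht, predictionTransfer_eq_zero (hquiet θ).1]
      have h := (hg θ i (Function.update (fun _ => θ) i t) θ rfl fun k hk => by
        rw [Function.update_self, ht k hk]).1
      rw [Function.update_idem, Function.update_eq_self i fun _ => θ] at h
      linarith
    · push Not at ht
      obtain ⟨k, hki, hk⟩ := ht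
      have h1 := predictionTransfer_update_const_le hI (c := normType w a₀) (P := L + 1)
        (by linarith) hki hk
      have h2 := hL (θ, i, Function.update (fun _ => θ) i t, fun _ => θ)
      dsimp only at h2
      linarith
  · rintro m ⟨σ, hσ, hm⟩
    have hpos : ∀ j, 0 < σ j (m j) := fun j =>
      lt_of_le_of_ne ((hσ.1 j).1 _) (Ne.symm (Finset.prod_ne_zero_iff.1 hm.ne' j
        (Finset.mem_univ j)))
    obtain ⟨hq, hE⟩ := quiet_of_undominated hI hprod hstc hst (E := CanChallenge w f)
      (fun k s t t' h => CanChallenge.of_normType_eq hB h)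
      (fun k s t h => not_canChallenge_of_normType_eq hB h)
      (θ := θ) (v := fun i m => uT w i (g m) θ)
      (fun i m m' => hL (θ, i, m, m')) (lt_add_one L)
      (fun j m t h1 h2 => (hg θ j m t h1 h2).1) (fun j m t h1 h2 => (hg θ j m t h1 h2).2)
      (S := fun j => {t | 0 < σ j t}) (fun i m₀ t h h' => hσ.update_le i m₀ t h h') m hpos
    exact ⟨(hgq m hq).trans (hfst _ _ hE), predictionTransfer_eq_zero hq.1⟩

end
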